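/- Abstract form of the paper's Lemma 3.4 (linear part): ker d_ε is a K[ε]-submodule of V[ε], so (ε−1)·ker d_ε ⊆ ker d_ε. The map sending an element F ∈ ker d with homogeneous components F^(k) ∈ V_k (F^(k) = 0 for k > n) to the class of Σ_{k=0}^n ε^{n−k}·F^(k) in ker d_ε / (ε−1)·ker d_ε is well defined (independent of the choice of n at least the top degree of F), K-linear, and bijective. -/

import Mathlib

/-!
Statement 4 (abstract form of the paper's Lemma 3.4): `ker d_ε` is closed under
multiplication by `ε - 1` (being a `K[ε]`-submodule), and the map sending `F ∈ ker d`,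
with homogeneous components `F^(k) ∈ V_k`, to the class of `Σ_k ε^{n-k}·F^(k)` in
`ker d_ε / (ε-1)·ker d_ε` is well defined (independent of `n` at least the top degree
of `F`), `K`-linear and bijective.
-/

open Polynomial

noncomputable section

variable (K V : Type*) [Field K] [AddCommGroup V] [Module K V]

/-- Multiplication by `ε - 1` on `V[ε]`, as a `K`-linear map. -/
def shiftE : PolynomialModule K V →ₗ[K] PolynomialModule K V :=
  LinearMap.restrictScalars K
    (((X : Polynomial K) - 1) •
      (LinearMap.id : PolynomialModule K V →ₗ[Polynomial K] PolynomialModule K V))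

/-- The kernel of `d_ε`, as a `K`-subspace of `V[ε]`. -/
def kerE {W : Type*} [AddCommGroup W] [Module K W]
    (dE : PolynomialModule K V →ₗ[Polynomial K] PolynomialModule K W) :
    Submodule K (PolynomialModule K V) :=
  (LinearMap.ker dE).restrictScalars K

/-- The subspace `(ε - 1)·ker d_ε` of `ker d_ε`. -/
def epsSub {W : Type*} [AddCommGroup W] [Module K W]
    (dE : PolynomialModule K V →ₗ[Polynomial K] PolynomialModule K W) :
    Submodule K ↥(kerE K V dE) :=
  Submodule.comap (kerE K V dE).subtype (Submodule.map (shiftE K V) (kerE K V dE))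

theorem aux_shift_apply (G : PolynomialModule K V) :
    shiftE K V G = ((X : Polynomial K) - 1) • G := rfl

theorem aux_shift_single (k : ℕ) (v : V) :
    shiftE K V (PolynomialModule.single K k v)
      = PolynomialModule.single K (k + 1) v - PolynomialModule.single K k v := by
  rw [aux_shift_apply, sub_smul, one_smul, ← monomial_one_one_eq_X,
    PolynomialModule.monomial_smul_single, one_smul, add_comm]

theorem aux_eval_shift (G : PolynomialModule K V) :
    PolynomialModule.eval (1 : K) (shiftE K V G) = 0 := by
  induction G using PolynomialModule.induction_linear with
  | zero => simp
  | add x y hx hy => simp [hx, hy]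
  | single n m => simp [aux_shift_single, PolynomialModule.eval_single]

theorem aux_shift_inj (G : PolynomialModule K V) (h : shiftE K V G = 0) : G = 0 := by
  rw [aux_shift_apply, sub_smul, one_smul, ← monomial_one_one_eq_X] at h
  have hc : ∀ n, (((monomial 1 (1 : K)) • G - G).coeff) n = 0 := by
    intro n; rw [h]; simp
  have hc' : ∀ n, ((monomial 1 (1 : K)) • G).coeff n = G.coeff n := by
    intro n
    rw [sub_eq_zero] at h
    rw [h]
  apply PolynomialModule.ext
  ext n
  induction n with
  | zero => rw [← hc' 0]; simp
  | succ n ih => rw [← hc' (n + 1)]; simpa using ih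

theorem aux_div (G : PolynomialModule K V) :
    ∃ H, G - PolynomialModule.single K 0 (PolynomialModule.eval (1 : K) G) = shiftE K V H := by
  induction G using PolynomialModule.induction_linear with
  | zero => exact ⟨0, by simp⟩
  | add x y hx hy =>
    obtain ⟨a, ha⟩ := hx
    obtain ⟨b, hb⟩ := hy
    refine ⟨a + b, ?_⟩
    rw [map_add, map_add, ← ha, ← hb, PolynomialModule.single_add]
    abel
  | single n m =>
    induction n with
    | zero => exact ⟨0, by simp [PolynomialModule.eval_single]⟩
    | succ n ih =>
      obtain ⟨H, hH⟩ := ih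
      refine ⟨H + PolynomialModule.single K n m, ?_⟩
      rw [map_add, ← hH, aux_shift_single]
      simp [PolynomialModule.eval_single]

theorem aux_decomp (Vg : ℕ → Submodule K V) (hVg : DirectSum.IsInternal Vg) (v : V) :
    ∃ (n : ℕ) (Fc : ℕ → V), (∀ k, Fc k ∈ Vg k) ∧ (∀ k, n < k → Fc k = 0) ∧
      ∑ k ∈ Finset.range (n + 1), Fc k = v := by
  classical
  obtain ⟨x, hx⟩ := hVg.2 v
  refine ⟨x.support.sup id, fun k => x k, fun k => (x k).2, ?_, ?_⟩
  · intro k hk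
    by_contra hne
    have : k ∈ x.support := by
      rw [DFinsupp.mem_support_iff]
      intro h0
      exact hne (by simp [h0])
    exact absurd (Finset.le_sup (f := id) this) (not_le.mpr hk)
  · rw [← hx, DirectSum.coeAddMonoidHom_eq_dfinsuppSum, DFinsupp.sum]
    symm
    apply Finset.sum_subset
    · intro k hk
      exact Finset.mem_range_succ_iff.mpr (Finset.le_sup (f := id) hk)
    · intro k _ hk
      simpa using hk

theorem aux_hom (Vg : ℕ → Submodule K V) (hVg : DirectSum.IsInternal Vg) (N : ℕ)
    (P : PolynomialModule K V)
    (hP : ∀ m, (m ≤ N → P.coeff m ∈ Vg (N - m)) ∧ (N < m → P.coeff m = 0))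
    (h0 : PolynomialModule.eval (1 : K) P = 0) : P = 0 := by
  classical
  have h1 : ∑ m ∈ Finset.range (N + 1), P.coeff m = 0 := by
    rw [← h0, PolynomialModule.eval_apply, Finsupp.sum]
    simp only [one_pow, one_smul]
    symm
    apply Finset.sum_subset
    · intro m hm
      rw [Finset.mem_range_succ_iff]
      by_contra hlt
      exact (Finsupp.mem_support_iff.mp hm) ((hP m).2 (not_le.mp hlt))
    · intro m _ hm
      simpa using hm
  rw [← Finset.sum_range_reflect] at h1
  have h2 := (iSupIndep_iff_finsetSum_eq_zero_imp_eq_zero Vg).mp hVg.submodule_iSupIndep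
    (Finset.range (N + 1)) (fun m => P.coeff (N + 1 - 1 - m)) ?_ h1
  · apply PolynomialModule.ext
    ext m
    by_cases hm : m ≤ N
    · have := h2 (N - m) (by simp)
      simpa [Nat.sub_sub_self hm] using this
    · exact (hP m).2 (not_le.mp hm)
  · intro m hm
    have hm' : m ≤ N := Finset.mem_range_succ_iff.mp hm
    have := (hP (N - m)).1 (Nat.sub_le _ _)
    simpa [Nat.sub_sub_self hm'] using this

theorem stmt4 (W : Type*) [AddCommGroup W] [Module K W]
    (Vg : ℕ → Submodule K V) (Wg : ℕ → Submodule K W)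
    (hVg : DirectSum.IsInternal Vg) (hWg : DirectSum.IsInternal Wg)
    (d : ℕ → V →ₗ[K] W) (hd0 : d 0 = 0)
    (hd : ∀ i, 1 ≤ i → ∀ k, ∀ x ∈ Vg k,
      (i ≤ k + 1 → d i x ∈ Wg (k + 1 - i)) ∧ (k + 1 < i → d i x = 0))
    -- the total differential `d = Σ_i d_i`
    (dtot : V →ₗ[K] W) (hdtot : ∀ v, dtot v = ∑ᶠ i, d i v)
    -- the `K[ε]`-linear differential `d_ε = Σ_i ε^i d_i` on `V[ε]`
    (dE : PolynomialModule K V →ₗ[Polynomial K] PolynomialModule K W)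
    (hdE : ∀ (k : ℕ) (v : V),
      dE (PolynomialModule.single K k v)
        = ∑ᶠ i, PolynomialModule.single K (i + k) (d i v)) :
    -- `ker d_ε` is a `K[ε]`-submodule, in particular `(ε-1)·ker d_ε ⊆ ker d_ε`
    (∀ G : PolynomialModule K V, dE G = 0 → dE (shiftE K V G) = 0) ∧
    -- the map `F ↦ [Σ_k ε^{n-k}·F^(k)]` is well defined, `K`-linear and bijective
    ∃ φ : ↥(LinearMap.ker dtot) →ₗ[K] (↥(kerE K V dE) ⧸ epsSub K V dE),
      Function.Bijective φ ∧
      ∀ (n : ℕ) (Fc : ℕ → V), (∀ k, Fc k ∈ Vg k) → (∀ k, n < k → Fc k = 0) →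
        ∀ hF : (∑ k ∈ Finset.range (n + 1), Fc k) ∈ LinearMap.ker dtot,
          ∃ hE : (∑ k ∈ Finset.range (n + 1),
              PolynomialModule.single K (n - k) (Fc k)) ∈ kerE K V dE,
            φ ⟨∑ k ∈ Finset.range (n + 1), Fc k, hF⟩
              = Submodule.Quotient.mk
                  (⟨∑ k ∈ Finset.range (n + 1),
                      PolynomialModule.single K (n - k) (Fc k), hE⟩ :
                    ↥(kerE K V dE)) := by
  have hshift : ∀ G : PolynomialModule K V, dE (shiftE K V G) = shiftE K W (dE G) := by
    intro G
    rw [aux_shift_apply, aux_shift_apply, map_smul]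
  have hmem : ∀ G : PolynomialModule K V, G ∈ kerE K V dE ↔ dE G = 0 := fun G => Iff.rfl
  -- on each graded piece the sums are finite
  have hz : ∀ k, ∀ x ∈ Vg k, ∀ i, i ∉ Finset.range (k + 2) → d i x = 0 := by
    intro k x hx i hi
    have hi' : k + 1 < i := by rw [Finset.mem_range] at hi; omega
    exact (hd i (by omega) k x hx).2 hi'
  have hdE' : ∀ k, ∀ x ∈ Vg k, ∀ j, dE (PolynomialModule.single K j x)
      = ∑ i ∈ Finset.range (k + 2), PolynomialModule.single K (i + j) (d i x) := by
    intro k x hx j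
    rw [hdE]
    apply finsum_eq_sum_of_support_subset
    intro i hi
    by_contra hn
    exact hi (by simp [hz k x hx i hn])
  have hdt' : ∀ k, ∀ x ∈ Vg k, dtot x = ∑ i ∈ Finset.range (k + 2), d i x := by
    intro k x hx
    rw [hdtot]
    apply finsum_eq_sum_of_support_subset
    intro i hi
    by_contra hn
    exact hi (by simp [hz k x hx i hn])
  have hev : ∀ G : PolynomialModule K V,
      PolynomialModule.eval (1 : K) (dE G) = dtot (PolynomialModule.eval (1 : K) G) := by
    intro G
    induction G using PolynomialModule.induction_linear with
    | zero => simp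
    | add x y hx hy => simp [hx, hy]
    | single j v =>
      obtain ⟨n, Fc, hFc, -, rfl⟩ := aux_decomp K V Vg hVg v
      have e1 : PolynomialModule.single K j (∑ k ∈ Finset.range (n + 1), Fc k)
          = ∑ k ∈ Finset.range (n + 1), PolynomialModule.single K j (Fc k) :=
        map_sum (PolynomialModule.lsingle K j) _ _
      simp only [e1, map_sum]
      refine Finset.sum_congr rfl fun k _ => ?_
      rw [hdE' k _ (hFc k), map_sum]
      simp only [PolynomialModule.eval_single, one_pow, one_smul]
      rw [hdt' k _ (hFc k)]
  have hevh : ∀ (n : ℕ) (Fc : ℕ → V), PolynomialModule.eval (1 : K)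
      (∑ k ∈ Finset.range (n + 1), PolynomialModule.single K (n - k) (Fc k))
        = ∑ k ∈ Finset.range (n + 1), Fc k := by
    intro n Fc
    simp [PolynomialModule.eval_single]
  have hhom : ∀ (n : ℕ) (Fc : ℕ → V), (∀ k, Fc k ∈ Vg k) →
      (∑ k ∈ Finset.range (n + 1), Fc k) ∈ LinearMap.ker dtot →
      (∑ k ∈ Finset.range (n + 1), PolynomialModule.single K (n - k) (Fc k))
        ∈ kerE K V dE := by
    intro n Fc hFc hF
    rw [hmem]
    apply aux_hom K W Wg hWg (n + 1)
    · intro m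
      have hco : (dE (∑ k ∈ Finset.range (n + 1),
          PolynomialModule.single K (n - k) (Fc k))).coeff m
          = ∑ k ∈ Finset.range (n + 1), ∑ i ∈ Finset.range (k + 2),
            if i + (n - k) = m then d i (Fc k) else 0 := by
        rw [map_sum, PolynomialModule.coeff_sum, Finsupp.finsetSum_apply]
        refine Finset.sum_congr rfl fun k _ => ?_
        rw [hdE' k _ (hFc k), PolynomialModule.coeff_sum, Finsupp.finsetSum_apply]
        refine Finset.sum_congr rfl fun i _ => ?_
        rw [PolynomialModule.coeff_single, Finsupp.single_apply]
      rw [hco]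
      constructor
      · intro hm
        refine Submodule.sum_mem _ fun k hk => Submodule.sum_mem _ fun i hi => ?_
        rw [Finset.mem_range] at hk hi
        split_ifs with h
        · rcases Nat.eq_zero_or_pos i with rfl | hpos
          · simp [hd0]
          · have := (hd i hpos k _ (hFc k)).1 (by omega)
            have e : n + 1 - m = k + 1 - i := by omega
            rwa [e]
        · exact Submodule.zero_mem _
      · intro hm
        refine Finset.sum_eq_zero fun k hk => Finset.sum_eq_zero fun i hi => ?_
        rw [Finset.mem_range] at hk hi
        rw [if_neg (by omega)]
    · rw [hev, hevh]
      exact hF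
  refine ⟨fun G hG => by rw [hshift, hG, map_zero], ?_⟩
  -- evaluation at `ε = 1`
  let ψ : ↥(kerE K V dE) →ₗ[K] ↥(LinearMap.ker dtot) :=
    LinearMap.codRestrict (LinearMap.ker dtot)
      ((PolynomialModule.eval (1 : K)).comp (kerE K V dE).subtype) (fun G => by
        have h : dE (G : PolynomialModule K V) = 0 := G.2
        rw [LinearMap.mem_ker, LinearMap.comp_apply, Submodule.subtype_apply, ← hev, h, map_zero])
  have hψ : ∀ G, ((ψ G : ↥(LinearMap.ker dtot)) : V)
      = PolynomialModule.eval (1 : K) (G : PolynomialModule K V) := fun G => rfl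
  have hker : LinearMap.ker ψ = epsSub K V dE := by
    ext G
    rw [LinearMap.mem_ker, ← Subtype.coe_inj, hψ]
    constructor
    · intro h
      obtain ⟨H, hH⟩ := aux_div K V (G : PolynomialModule K V)
      rw [h] at hH
      simp only [ZeroMemClass.coe_zero, PolynomialModule.single_zero, sub_zero] at hH
      refine ⟨H, ?_, hH.symm⟩
      have hG : dE (G : PolynomialModule K V) = 0 := G.2
      exact aux_shift_inj K W _ (by rw [← hshift, ← hH, hG])
    · rintro ⟨H, _, hH⟩
      have hH' : shiftE K V H = (G : PolynomialModule K V) := hH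
      rw [← hH', aux_eval_shift]
      rfl
  have hsurj : Function.Surjective ψ := by
    rintro ⟨v, hv⟩
    obtain ⟨n, Fc, hFc, -, rfl⟩ := aux_decomp K V Vg hVg v
    exact ⟨⟨_, hhom n Fc hFc hv⟩, Subtype.ext (hevh n Fc)⟩
  let e : (↥(kerE K V dE) ⧸ epsSub K V dE) ≃ₗ[K] ↥(LinearMap.ker dtot) :=
    (Submodule.quotEquivOfEq _ _ hker.symm).trans (ψ.quotKerEquivOfSurjective hsurj)
  have he : ∀ G, e (Submodule.Quotient.mk G) = ψ G := fun G => rfl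
  refine ⟨e.symm.toLinearMap, e.symm.bijective, ?_⟩
  intro n Fc hFc _ hF
  refine ⟨hhom n Fc hFc hF, ?_⟩
  rw [LinearEquiv.coe_coe, LinearEquiv.symm_apply_eq, he]
  exact Subtype.ext (hevh n Fc).symm

end
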